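/- Fix k > 0 and let p be a Borel probability measure on S with p({γ = k}) = 0 and p({γ < k}) > 0. Then the map p′ ↦ α_{p′}(k), from the space of Borel probability measures on S with the topology of weak convergence to [0,1], is continuous at the point p. -/

import Mathlib

open MeasureTheory Set Filter Topology
open scoped ENNReal NNReal

/-- The space `S = {I,II} × [0,∞) × ℕ`; `true` stands for Player I,
`false` for Player II. -/
abbrev GameS : Type := Bool × ℝ≥0 × ℕ

/-- `pk p i k n = p({ι = i} ∩ {γ ≥ k} ∩ {ξ = n})`. -/
noncomputable def pk (p : Measure GameS) (i : Bool) (k : ℝ≥0) (n : ℕ) : ℝ :=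
  (p {s : GameS | s.1 = i ∧ k ≤ s.2.1 ∧ s.2.2 = n}).toReal

/-- The generating function `G_i(k,x) = Σ_n p_i(k,n) xⁿ`. -/
noncomputable def Gk (p : Measure GameS) (i : Bool) (k : ℝ≥0) (x : ℝ) : ℝ :=
  ∑' n : ℕ, pk p i k n * x ^ n

/-- The value generating function
`f(k,x) = 1 − G_I(k,0) − G_I(k,1) + G_I(k,x) − G_II(k,1−x)`. -/
noncomputable def vgf (p : Measure GameS) (k : ℝ≥0) (x : ℝ) : ℝ :=
  1 - Gk p true k 0 - Gk p true k 1 + Gk p true k x - Gk p false k (1 - x)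


/-- `α_p(k)`: the smallest fixed point of `f_k` in `[0,1]`. -/
noncomputable def alphaP (p : Measure GameS) (k : ℝ≥0) : ℝ :=
  sInf {x ∈ Set.Icc (0:ℝ) 1 | vgf p k x = x}

lemma pk_nonneg (p : Measure GameS) (i : Bool) (k : ℝ≥0) (n : ℕ) : 0 ≤ pk p i k n :=
  ENNReal.toReal_nonneg

lemma measurableSet_player_capacity (i : Bool) (k : ℝ≥0) :
    MeasurableSet {s : GameS | s.1 = i ∧ k ≤ s.2.1} :=
  ((isClosed_eq (by fun_prop) (by fun_prop)).inter
    (isClosed_le (by fun_prop) (by fun_prop))).measurableSet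

lemma measurableSet_player_capacity_children (i : Bool) (k : ℝ≥0) (n : ℕ) :
    MeasurableSet {s : GameS | s.1 = i ∧ k ≤ s.2.1 ∧ s.2.2 = n} :=
  ((isClosed_eq (by fun_prop) (by fun_prop)).inter
    ((isClosed_le (by fun_prop) (by fun_prop)).inter
      (isClosed_eq (by fun_prop) (by fun_prop)))).measurableSet

/-- The numbers `p_i(k,n)` sum up to `p({ι = i} ∩ {γ ≥ k})`. -/
lemma hasSum_pk (p : Measure GameS) [IsProbabilityMeasure p] (i : Bool) (k : ℝ≥0) :
    HasSum (pk p i k) (p {s : GameS | s.1 = i ∧ k ≤ s.2.1}).toReal := by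
  have hU : {s : GameS | s.1 = i ∧ k ≤ s.2.1} =
      ⋃ n : ℕ, {s : GameS | s.1 = i ∧ k ≤ s.2.1 ∧ s.2.2 = n} := by
    ext s
    simp
  have hdisj : Pairwise (Function.onFun Disjoint
      fun n : ℕ => {s : GameS | s.1 = i ∧ k ≤ s.2.1 ∧ s.2.2 = n}) := by
    intro m n hmn
    refine Set.disjoint_left.2 fun s hs ht => hmn ?_
    exact hs.2.2.symm.trans ht.2.2
  have hsum := measure_iUnion (μ := p) hdisj (measurableSet_player_capacity_children i k)
  have hne := measure_ne_top p {s : GameS | s.1 = i ∧ k ≤ s.2.1}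
  rw [hU, hsum] at hne ⊢
  rw [ENNReal.tsum_toReal_eq (ENNReal.ne_top_of_tsum_ne_top hne)]
  exact ENNReal.hasSum_toReal hne

lemma Gk_one (p : Measure GameS) [IsProbabilityMeasure p] (i : Bool) (k : ℝ≥0) :
    Gk p i k 1 = (p {s : GameS | s.1 = i ∧ k ≤ s.2.1}).toReal := by
  simpa [Gk] using (hasSum_pk p i k).tsum_eq

lemma pk_le_one (p : Measure GameS) [IsProbabilityMeasure p] (i : Bool) (k : ℝ≥0) (n : ℕ) :
    pk p i k n ≤ 1 := by
  have h := ENNReal.toReal_mono ENNReal.one_ne_top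
    (prob_le_one (μ := p) (s := {s : GameS | s.1 = i ∧ k ≤ s.2.1 ∧ s.2.2 = n}))
  simpa [pk] using h

lemma norm_pk_mul_pow_le (p : Measure GameS) (i : Bool) (k : ℝ≥0) (n : ℕ) {x : ℝ}
    (hx : x ∈ Icc (0 : ℝ) 1) : ‖pk p i k n * x ^ n‖ ≤ pk p i k n := by
  rw [Real.norm_of_nonneg (mul_nonneg (pk_nonneg p i k n) (pow_nonneg hx.1 n))]
  exact mul_le_of_le_one_right (pk_nonneg p i k n) (pow_le_one₀ hx.1 hx.2)

lemma hasSum_Gk (p : Measure GameS) [IsProbabilityMeasure p] (i : Bool) (k : ℝ≥0) {x : ℝ}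
    (hx : x ∈ Icc (0 : ℝ) 1) : HasSum (fun n => pk p i k n * x ^ n) (Gk p i k x) :=
  (Summable.of_norm_bounded (hasSum_pk p i k).summable
    fun n => norm_pk_mul_pow_le p i k n hx).hasSum

lemma Gk_nonneg (p : Measure GameS) (i : Bool) (k : ℝ≥0) {x : ℝ} (hx : 0 ≤ x) :
    0 ≤ Gk p i k x :=
  tsum_nonneg fun n => mul_nonneg (pk_nonneg p i k n) (pow_nonneg hx n)

lemma continuousOn_Gk (p : Measure GameS) [IsProbabilityMeasure p] (i : Bool) (k : ℝ≥0) :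
    ContinuousOn (Gk p i k) (Icc 0 1) :=
  continuousOn_tsum (fun n => by fun_prop) (hasSum_pk p i k).summable
    fun n _ hx => norm_pk_mul_pow_le p i k n hx

lemma continuousOn_vgf (p : Measure GameS) [IsProbabilityMeasure p] (k : ℝ≥0) :
    ContinuousOn (vgf p k) (Icc 0 1) := by
  have h : ContinuousOn (fun x => Gk p false k (1 - x)) (Icc 0 1) :=
    (continuousOn_Gk p false k).comp (by fun_prop)
      fun x hx => ⟨sub_nonneg.2 hx.2, sub_le_self _ hx.1⟩
  exact (continuousOn_const.add (continuousOn_Gk p true k)).sub h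

lemma vgf_zero (p : Measure GameS) [IsProbabilityMeasure p] (k : ℝ≥0) :
    vgf p k 0 = (p {s : GameS | s.2.1 < k}).toReal := by
  have hlt : MeasurableSet {s : GameS | s.2.1 < k} :=
    (isOpen_lt (by fun_prop) (by fun_prop)).measurableSet
  have hcompl : {s : GameS | s.2.1 < k}ᶜ =
      {s : GameS | s.1 = true ∧ k ≤ s.2.1} ∪ {s : GameS | s.1 = false ∧ k ≤ s.2.1} := by
    ext ⟨i, c, n⟩
    cases i <;> simp
  have hdisj : Disjoint {s : GameS | s.1 = true ∧ k ≤ s.2.1}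
      {s : GameS | s.1 = false ∧ k ≤ s.2.1} :=
    Set.disjoint_left.2 fun s hs ht => Bool.noConfusion (hs.1.symm.trans ht.1)
  have hadd := measureReal_add_measureReal_compl (μ := p) hlt
  rw [hcompl, measureReal_union hdisj (measurableSet_player_capacity false k)] at hadd
  simp only [measureReal_def, measure_univ, ENNReal.toReal_one] at hadd
  simp only [vgf, sub_zero, Gk_one]
  linarith

lemma vgf_one_le (p : Measure GameS) (k : ℝ≥0) : vgf p k 1 ≤ 1 := by
  have h1 := Gk_nonneg p true k le_rfl
  have h2 := Gk_nonneg p false k le_rfl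
  simp only [vgf, sub_self]
  linarith

/-- The third divided difference of `x ^ n` at the nodes `0, a, y, 1` is nonnegative. -/
lemma pow_dividedDifference_nonneg {a y : ℝ} (ha : 0 ≤ a) (hay : a < y) (hy : y ≤ 1) (n : ℕ) :
    0 ≤ -(0 ^ n * ((y - a) * (1 - y) * (1 - a))) + a ^ n * (y * (1 - y))
      - y ^ n * (a * (1 - a)) + 1 ^ n * (a * y * (y - a)) := by
  cases n with
  | zero =>
    apply le_of_eq
    ring
  | succ m =>
    have h1a : 0 < 1 - a := by linarith
    have hconv := (convexOn_pow (𝕜 := ℝ) m).2 (mem_Ici.2 ha) (mem_Ici.2 zero_le_one)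
      (div_nonneg (sub_nonneg.2 hy) h1a.le) (div_nonneg (sub_nonneg.2 hay.le) h1a.le)
      (by field_simp; ring)
    have hcomb : (1 - y) / (1 - a) * a + (y - a) / (1 - a) * 1 = y := by
      field_simp
      ring
    simp only [smul_eq_mul, hcomb, one_pow] at hconv
    have hm : y ^ m * (1 - a) ≤ (1 - y) * a ^ m + (y - a) := by
      calc y ^ m * (1 - a)
          ≤ ((1 - y) / (1 - a) * a ^ m + (y - a) / (1 - a) * 1) * (1 - a) :=
            mul_le_mul_of_nonneg_right hconv h1a.le
        _ = (1 - y) * a ^ m + (y - a) := by field_simp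
    have hmul := mul_nonneg (mul_nonneg ha (ha.trans hay.le)) (sub_nonneg.2 hm)
    calc (0 : ℝ) ≤ _ := hmul
      _ = _ := by ring

/-- The third divided difference of a generating function at `0, a, y, 1` is nonnegative. -/
lemma Gk_dividedDifference_nonneg (p : Measure GameS) [IsProbabilityMeasure p] (i : Bool)
    (k : ℝ≥0) {a y : ℝ} (ha : 0 ≤ a) (hay : a < y) (hy : y ≤ 1) :
    0 ≤ -(Gk p i k 0 * ((y - a) * (1 - y) * (1 - a))) + Gk p i k a * (y * (1 - y))
      - Gk p i k y * (a * (1 - a)) + Gk p i k 1 * (a * y * (y - a)) := by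
  have h0 := hasSum_Gk p i k (x := 0) (by simp)
  have h1 := hasSum_Gk p i k (x := 1) (by simp)
  have h2 := hasSum_Gk p i k (x := a) ⟨ha, hay.le.trans hy⟩
  have h3 := hasSum_Gk p i k (x := y) ⟨ha.trans hay.le, hy⟩
  refine ((((h0.mul_right _).neg.add (h2.mul_right _)).sub (h3.mul_right _)).add
    (h1.mul_right _)).nonneg fun n => ?_
  calc (0 : ℝ) ≤ _ := mul_nonneg (pk_nonneg p i k n) (pow_dividedDifference_nonneg ha hay hy n)
    _ = _ := by ring

/-- The third divided difference of the vgf at `0, a, y, 1` is nonnegative. -/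
lemma vgf_dividedDifference_nonneg (p : Measure GameS) [IsProbabilityMeasure p]
    (k : ℝ≥0) {a y : ℝ} (ha : 0 ≤ a) (hay : a < y) (hy : y ≤ 1) :
    0 ≤ -(vgf p k 0 * ((y - a) * (1 - y) * (1 - a))) + vgf p k a * (y * (1 - y))
      - vgf p k y * (a * (1 - a)) + vgf p k 1 * (a * y * (y - a)) := by
  have h1 := Gk_dividedDifference_nonneg p true k ha hay hy
  have h2 := Gk_dividedDifference_nonneg p false k (a := 1 - y) (y := 1 - a)
    (by linarith) (by linarith) (by linarith)
  simp only [vgf, sub_zero, sub_self]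
  calc (0 : ℝ) ≤ _ := add_nonneg h1 h2
    _ = _ := by ring

/-- To the right of a fixed point in `(0, 1)`, the vgf lies strictly below the diagonal. -/
lemma vgf_lt_of_fixed (p : Measure GameS) [IsProbabilityMeasure p] (k : ℝ≥0)
    (h0 : 0 < vgf p k 0) {a y : ℝ} (ha : 0 < a) (hay : a < y) (hy : y < 1)
    (hfix : vgf p k a = a) : vgf p k y < y := by
  have h := vgf_dividedDifference_nonneg p k ha.le hay hy.le
  rw [hfix] at h
  by_contra! hle
  have e0 : 0 < vgf p k 0 * ((y - a) * (1 - y) * (1 - a)) :=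
    mul_pos h0 (mul_pos (mul_pos (by linarith) (by linarith)) (by linarith))
  have e1 : 0 ≤ (vgf p k y - y) * (a * (1 - a)) :=
    mul_nonneg (by linarith) (mul_nonneg ha.le (by linarith))
  have e2 : 0 ≤ (1 - vgf p k 1) * (a * y * (y - a)) :=
    mul_nonneg (sub_nonneg.2 (vgf_one_le p k))
      (mul_nonneg (mul_nonneg ha.le (by linarith)) (by linarith))
  linarith

/-- If the vgf is weakly below the diagonal at `y`, it has a fixed point in `[0, y]`. -/
lemma exists_fixed_le (p : Measure GameS) [IsProbabilityMeasure p] (k : ℝ≥0) {y : ℝ}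
    (hy : y ∈ Icc (0 : ℝ) 1) (hle : vgf p k y ≤ y) : ∃ x ∈ Icc 0 y, vgf p k x = x := by
  have hcont : ContinuousOn (fun x => vgf p k x - x) (Icc 0 y) :=
    ((continuousOn_vgf p k).mono (Icc_subset_Icc_right hy.2)).sub continuousOn_id
  have h0 : 0 ≤ vgf p k 0 - 0 := by
    rw [vgf_zero, sub_zero]
    exact ENNReal.toReal_nonneg
  obtain ⟨x, hx, hfx⟩ := intermediate_value_Icc' hy.1 hcont ⟨sub_nonpos.2 hle, h0⟩
  exact ⟨x, hx, sub_eq_zero.1 hfx⟩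

lemma alphaP_le {p : Measure GameS} {k : ℝ≥0} {x : ℝ}
    (hx : x ∈ Icc (0 : ℝ) 1) (hfix : vgf p k x = x) : alphaP p k ≤ x :=
  csInf_le ⟨0, fun _ h => h.1.1⟩ ⟨hx, hfix⟩

lemma alphaP_mem (p : Measure GameS) [IsProbabilityMeasure p] (k : ℝ≥0) :
    alphaP p k ∈ {x ∈ Icc (0 : ℝ) 1 | vgf p k x = x} := by
  have hclosed : IsClosed {x ∈ Icc (0 : ℝ) 1 | vgf p k x = x} := by
    have h := ((continuousOn_vgf p k).sub continuousOn_id).preimage_isClosed_of_isClosed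
      isClosed_Icc (isClosed_singleton (x := (0 : ℝ)))
    convert h using 1
    ext x
    simp [sub_eq_zero]
  refine hclosed.csInf_mem ?_ ⟨0, fun _ h => h.1.1⟩
  exact exists_fixed_le p k (right_mem_Icc.2 zero_le_one) (vgf_one_le p k)

lemma alphaP_le_of_vgf_le (p : Measure GameS) [IsProbabilityMeasure p] (k : ℝ≥0) {y : ℝ}
    (hy : y ∈ Icc (0 : ℝ) 1) (hle : vgf p k y ≤ y) : alphaP p k ≤ y := by
  obtain ⟨x, hx, hfix⟩ := exists_fixed_le p k hy hle
  exact (alphaP_le ⟨hx.1, hx.2.trans hy.2⟩ hfix).trans hx.2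

lemma alphaP_pos (p : Measure GameS) [IsProbabilityMeasure p] (k : ℝ≥0)
    (h0 : 0 < vgf p k 0) : 0 < alphaP p k := by
  obtain ⟨hmem, hfix⟩ := alphaP_mem p k
  refine hmem.1.lt_of_ne fun h => h0.ne' ?_
  rw [← h] at hfix
  exact hfix

lemma vgf_lt_of_alphaP_lt (p : Measure GameS) [IsProbabilityMeasure p] (k : ℝ≥0)
    (h0 : 0 < vgf p k 0) {y : ℝ} (hay : alphaP p k < y) (hy : y < 1) : vgf p k y < y :=
  vgf_lt_of_fixed p k h0 (alphaP_pos p k h0) hay hy (alphaP_mem p k).2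

lemma tendsto_measure_toReal {k : ℝ≥0} {p : ProbabilityMeasure GameS}
    (h1 : (p : Measure GameS) {s : GameS | s.2.1 = k} = 0) {E : Set GameS}
    (hE : frontier E ⊆ {s : GameS | s.2.1 = k}) :
    Tendsto (fun q : ProbabilityMeasure GameS => ((q : Measure GameS) E).toReal) (𝓝 p)
      (𝓝 ((p : Measure GameS) E).toReal) :=
  (ENNReal.tendsto_toReal (measure_ne_top _ _)).comp
    (ProbabilityMeasure.tendsto_measure_of_null_frontier_of_tendsto' tendsto_id
      (measure_mono_null hE h1))

lemma frontier_inter_capacity_subset {C : Set GameS} (hC : IsClopen C) (k : ℝ≥0) :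
    frontier (C ∩ {s : GameS | k ≤ s.2.1}) ⊆ {s : GameS | s.2.1 = k} := by
  refine (frontier_inter_subset _ _).trans ?_
  rw [hC.frontier_eq, empty_inter, empty_union]
  intro s hs
  exact (frontier_le_subset_eq (f := fun _ : GameS => k) (g := fun s : GameS => s.2.1)
    (by fun_prop) (by fun_prop) hs.2).symm

lemma isClopen_player (i : Bool) : IsClopen {s : GameS | s.1 = i} :=
  (isClopen_discrete {i}).preimage (continuous_fst (X := Bool) (Y := ℝ≥0 × ℕ))

lemma isClopen_children (n : ℕ) : IsClopen {s : GameS | s.2.2 = n} :=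
  (isClopen_discrete {n}).preimage (f := fun s : GameS => s.2.2) (by fun_prop)

lemma tendsto_pk {k : ℝ≥0} {p : ProbabilityMeasure GameS}
    (h1 : (p : Measure GameS) {s : GameS | s.2.1 = k} = 0) (i : Bool) (n : ℕ) :
    Tendsto (fun q : ProbabilityMeasure GameS => pk (q : Measure GameS) i k n) (𝓝 p)
      (𝓝 (pk (p : Measure GameS) i k n)) := by
  refine tendsto_measure_toReal h1 ?_
  have h := frontier_inter_capacity_subset ((isClopen_player i).inter (isClopen_children n)) k
  convert h using 2
  ext s
  simp only [mem_ofPred_eq, mem_inter_iff]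
  tauto

/-- Weak convergence implies pointwise convergence of the generating functions. -/
lemma tendsto_Gk {k : ℝ≥0} {p : ProbabilityMeasure GameS}
    (h1 : (p : Measure GameS) {s : GameS | s.2.1 = k} = 0) (i : Bool) {x : ℝ}
    (hx : x ∈ Icc (0 : ℝ) 1) :
    Tendsto (fun q : ProbabilityMeasure GameS => Gk (q : Measure GameS) i k x) (𝓝 p)
      (𝓝 (Gk (p : Measure GameS) i k x)) := by
  rcases hx.2.eq_or_lt with rfl | hlt
  · simp only [Gk_one]
    exact tendsto_measure_toReal h1 (frontier_inter_capacity_subset (isClopen_player i) k)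
  · refine tendsto_tsum_of_dominated_convergence (summable_geometric_of_lt_one hx.1 hlt)
      (fun n => (tendsto_pk h1 i n).mul_const _) (Eventually.of_forall fun q n => ?_)
    rw [Real.norm_of_nonneg (mul_nonneg (pk_nonneg _ i k n) (pow_nonneg hx.1 n))]
    exact mul_le_of_le_one_left (pow_nonneg hx.1 n) (pk_le_one _ i k n)

lemma tendsto_vgf {k : ℝ≥0} {p : ProbabilityMeasure GameS}
    (h1 : (p : Measure GameS) {s : GameS | s.2.1 = k} = 0) {x : ℝ} (hx : x ∈ Icc (0 : ℝ) 1) :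
    Tendsto (fun q : ProbabilityMeasure GameS => vgf (q : Measure GameS) k x) (𝓝 p)
      (𝓝 (vgf (p : Measure GameS) k x)) :=
  (((tendsto_const_nhds.sub (tendsto_Gk h1 true (by simp))).sub
    (tendsto_Gk h1 true (by simp))).add (tendsto_Gk h1 true hx)).sub
    (tendsto_Gk h1 false ⟨sub_nonneg.2 hx.2, sub_le_self _ hx.1⟩)

/-- for `k > 0` and a probability measure `p` on `S` with `p({γ = k}) = 0`
and `p({γ < k}) > 0`, the map `p′ ↦ α_{p′}(k)` (weak topology) is continuous at `p`. -/
theorem alphaP_continuousAt (k : ℝ≥0) (hk : 0 < k) (p : ProbabilityMeasure GameS)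
    (h1 : (p : Measure GameS) {s : GameS | s.2.1 = k} = 0)
    (h2 : 0 < (p : Measure GameS) {s : GameS | s.2.1 < k}) :
    ContinuousAt (fun p' : ProbabilityMeasure GameS => alphaP (p' : Measure GameS) k) p := by
  have h0 : 0 < vgf (p : Measure GameS) k 0 := by
    rw [vgf_zero]
    exact ENNReal.toReal_pos h2.ne' (measure_ne_top _ _)
  have hev0 : ∀ᶠ q : ProbabilityMeasure GameS in 𝓝 p, 0 < vgf (q : Measure GameS) k 0 :=
    (tendsto_vgf h1 (by simp)).eventually_const_lt h0
  have hα1 : alphaP (p : Measure GameS) k ≤ 1 := (alphaP_mem (p : Measure GameS) k).1.2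
  refine tendsto_order.2 ⟨fun b hb => ?_, fun b hb => ?_⟩
  · obtain ⟨z, hz, hzα⟩ := exists_between (max_lt hb (alphaP_pos (p : Measure GameS) k h0))
    obtain ⟨hbz, hz0⟩ := max_lt_iff.1 hz
    have hzmem : z ∈ Icc (0 : ℝ) 1 := ⟨hz0.le, hzα.le.trans hα1⟩
    have hpz : z < vgf (p : Measure GameS) k z := by
      by_contra! hle
      exact hzα.not_ge (alphaP_le_of_vgf_le _ k hzmem hle)
    filter_upwards [hev0, (tendsto_vgf h1 hzmem).eventually_const_lt hpz] with q hq0 hqz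
    by_contra! hle
    exact hqz.not_gt
      (vgf_lt_of_alphaP_lt (q : Measure GameS) k hq0 (hle.trans_lt hbz) (hzα.trans_le hα1))
  · rcases lt_or_ge 1 b with hb1 | hb1
    · exact Eventually.of_forall fun q => (alphaP_mem (q : Measure GameS) k).1.2.trans_lt hb1
    · obtain ⟨y, hαy, hyb⟩ := exists_between hb
      have hymem : y ∈ Icc (0 : ℝ) 1 :=
        ⟨(alphaP_mem (p : Measure GameS) k).1.1.trans hαy.le, hyb.le.trans hb1⟩
      have hpy := vgf_lt_of_alphaP_lt (p : Measure GameS) k h0 hαy (hyb.trans_le hb1)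
      filter_upwards [(tendsto_vgf h1 hymem).eventually_lt_const hpy] with q hqy
      exact (alphaP_le_of_vgf_le (q : Measure GameS) k hymem hqy.le).trans_lt hyb
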